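/- Let n ≥ 1 and let i, j ∈ {1,…,n} with i ≠ j. Then P(eᵢ − eⱼ) = {∑_{k=1}^n a_k e_k : a_i ∈ {0, −1}, a_j = 1 + a_i, and a_k ∈ {0, a_i, a_j} for all k ∈ {1,…,n} \ {i, j}}. -/

import Mathlib

open Pointwise

section Lattice

/-- The standard dot product on `ℤⁿ`. -/
def dotZ {n : ℕ} (x y : Fin n → ℤ) : ℤ := ∑ i, x i * y i

/-- The set of Demazure roots of a set `S ⊆ ℤⁿ`. -/
def demRoots {n : ℕ} (S : Set (Fin n → ℤ)) : Set (Fin n → ℤ) :=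
  {α | ∃ ρ ∈ S, dotZ ρ α = -1 ∧ ∀ ρ' ∈ S, ρ' ≠ ρ → 0 ≤ dotZ ρ' α}

/-- The standard basis vector `eᵢ` of `ℤⁿ`. -/
def eZ (n : ℕ) (i : Fin n) : Fin n → ℤ := Pi.single i 1

/-- `e₀ := −(e₁ + ⋯ + eₙ)`, i.e. the all-(−1) vector. -/
def e0Z (n : ℕ) : Fin n → ℤ := fun _ => -1

/-- `Sₙ := {e₀, e₁, …, eₙ}`, the 1-skeleton (ray generators) of `ℙⁿ`. -/
def SnZ (n : ℕ) : Set (Fin n → ℤ) := insert (e0Z n) (Set.range (eZ n))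

/-- `Rₙ := {eᵢ} ∪ {−eᵢ} ∪ {eᵢ − eⱼ : i ≠ j}`, the root system of `PGL_{n+1}`. -/
def RnZ (n : ℕ) : Set (Fin n → ℤ) :=
  Set.range (eZ n) ∪ Set.range (fun i => -eZ n i) ∪
    {α | ∃ i j : Fin n, i ≠ j ∧ α = eZ n i - eZ n j}

end Lattice

/-- `P(α)`: the integer vectors pairing to `−1` with `α` and `≥ −1` with every other root
in `Rₙ`. -/
def Pset (n : ℕ) (α : Fin n → ℤ) : Set (Fin n → ℤ) :=
  {p | dotZ p α = -1 ∧ ∀ α' ∈ RnZ n, α' ≠ α → -1 ≤ dotZ p α'}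

theorem dotZ_neg {n : ℕ} (p α : Fin n → ℤ) : dotZ p (-α) = -dotZ p α := by
  simp [dotZ]

theorem dotZ_sub {n : ℕ} (p α β : Fin n → ℤ) :
    dotZ p (α - β) = dotZ p α - dotZ p β := by
  simp [dotZ, mul_sub]

theorem dotZ_eZ {n : ℕ} (p : Fin n → ℤ) (i : Fin n) : dotZ p (eZ n i) = p i := by
  simp [dotZ, eZ, Pi.single_apply]

/-- The defining inequality of `P(α)` may be imposed on `α` itself, where it holds trivially. -/
theorem mem_Pset_iff {n : ℕ} {α p : Fin n → ℤ} :
    p ∈ Pset n α ↔ dotZ p α = -1 ∧ ∀ α' ∈ RnZ n, -1 ≤ dotZ p α' := by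
  refine and_congr_right fun hα => forall₂_congr fun α' _ => ⟨fun h => ?_, fun h _ => h⟩
  by_cases hα' : α' = α
  · rw [hα', hα]
  · exact h hα'

/-- Pairing to at least `-1` with every root, in coordinates. -/
theorem forall_mem_RnZ_iff {n : ℕ} {p : Fin n → ℤ} :
    (∀ α ∈ RnZ n, -1 ≤ dotZ p α) ↔
      (∀ k, -1 ≤ p k) ∧ (∀ k, p k ≤ 1) ∧ ∀ k l, k ≠ l → -1 ≤ p k - p l := by
  constructor
  · intro h
    refine ⟨fun k => ?_, fun k => ?_, fun k l hkl => ?_⟩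
    · simpa [dotZ_eZ] using h _ (Or.inl (Or.inl ⟨k, rfl⟩))
    · have := h _ (Or.inl (Or.inr ⟨k, rfl⟩))
      rw [dotZ_neg, dotZ_eZ] at this
      lia
    · simpa only [dotZ_sub, dotZ_eZ] using h _ (Or.inr ⟨k, l, hkl, rfl⟩)
  · rintro ⟨h₁, h₂, h₃⟩ _ ((⟨k, rfl⟩ | ⟨k, rfl⟩) | ⟨k, l, hkl, rfl⟩)
    · simpa only [dotZ_eZ] using h₁ k
    · simpa only [dotZ_neg, dotZ_eZ, neg_le_neg_iff] using h₂ k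
    · simpa only [dotZ_sub, dotZ_eZ] using h₃ k l hkl

/-- Description of `P(eᵢ − eⱼ)` for `i ≠ j`. -/
theorem Pset_eij (n : ℕ) (hn : 1 ≤ n) (i j : Fin n) (hij : i ≠ j) :
    Pset n (eZ n i - eZ n j) =
      {p | (p i = 0 ∨ p i = -1) ∧ p j = 1 + p i ∧
        ∀ k : Fin n, k ≠ i → k ≠ j → (p k = 0 ∨ p k = p i ∨ p k = p j)} := by
  ext p
  rw [mem_Pset_iff, forall_mem_RnZ_iff, dotZ_sub, dotZ_eZ, dotZ_eZ, Set.mem_ofPred_eq]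
  constructor
  · rintro ⟨h, hlo, hhi, hsub⟩
    have hi := hlo i
    have hj := hhi j
    refine ⟨by lia, by lia, fun k hki hkj => ?_⟩
    have := hlo k
    have := hhi k
    have := hsub i k hki.symm
    have := hsub k j hkj
    lia
  · rintro ⟨hi, hj, h⟩
    have bounds : ∀ k, p i ≤ p k ∧ p k ≤ p j := by
      intro k
      by_cases hki : k = i
      · subst hki; lia
      by_cases hkj : k = j
      · subst hkj; lia
      have := h k hki hkj
      lia
    refine ⟨by lia, fun k => ?_, fun k => ?_, fun k l _ => ?_⟩
    · have := bounds k
      lia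
    · have := bounds k
      lia
    · have := bounds k
      have := bounds l
      lia
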